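/- arXiv:0711.4929 — 5 statements merged into one kernel-verified Lean document; each statement's English description precedes it below -/
import Mathlib

section
/- For every integer n ≥ 2, the following identity holds in the field ℚ(t) of rational functions in one variable t over ℚ: A + B + C + D − E − F = ((1−t^{2n+8})/(1−t⁶) + 2(t⁴−t^{2n+2})/(1−t⁴)) · ((1−t^{2n})/(1−t²)) · ((1−t^{2n})(1−t^{2n−2})/((1−t²)(1−t⁴))), where A = (1−t^{4n−2})(1−t^{4n})/((1−t²)(1−t⁴)), B = ((t²−t^{6n−6})/(1−t²))·((1−t^{2n})/(1−t²)), C = ((t²−t^{4n−4})/(1−t²))·(1+t²+t⁴)·((1−t^{2n})(1−t^{2n−2})/((1−t²)(1−t⁴))), D = ((t²−t^{2n−2})/(1−t²))·(1+t²)·((1−t^{2n})²(1−t^{2n−2})/(1−t²)³), E = (t²/(1+t²))·[ (1+t²+t⁴)·((1−t^{2n})(1−t^{2n−2})(1−t^{4n−4})/((1−t²)²(1−t⁴))) + ((t²−t^{2n−2})/(1−t²))·(1+t²)²·((1−t^{2n−2})²(1−t^{2n})/((1−t²)²(1−t⁴))) ], and F = ((t²+t⁴)/(1+t²+t⁴))·((1−t^{2n})²(1−t^{2n−2})(1−t^{2n+2})/((1−t²)³(1−t⁴))).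 -/
theorem aux_field {K : Type*} [Field K] (q y : K) (h1 : 1 - q ≠ 0) (h2 : 1 + q ≠ 0)
    (h3 : 1 + q + q ^ 2 ≠ 0) :
    ((1 - q * y ^ 2) * (1 - q ^ 2 * y ^ 2) / ((1 - q) * ((1 - q) * (1 + q))))
    + (((q - y ^ 3) / (1 - q)) * ((1 - q * y) / (1 - q)))
    + (((q - y ^ 2) / (1 - q)) *
        ((1 + q + q ^ 2) *
          ((1 - q * y) * (1 - y) / ((1 - q) * ((1 - q) * (1 + q))))))
    + (((q - y) / (1 - q)) *
        ((1 + q) *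
          ((1 - q * y) ^ 2 * (1 - y) / (1 - q) ^ 3)))
    - ((q / (1 + q)) *
        ((1 + q + q ^ 2) *
            ((1 - q * y) * (1 - y) * (1 - y ^ 2) /
              ((1 - q) ^ 2 * ((1 - q) * (1 + q))))
          + ((q - y) / (1 - q)) * (1 + q) ^ 2 *
              ((1 - y) ^ 2 * (1 - q * y) /
                ((1 - q) ^ 2 * ((1 - q) * (1 + q))))))
    - (((q + q ^ 2) / (1 + q + q ^ 2)) *
        ((1 - q * y) ^ 2 * (1 - y) * (1 - q ^ 2 * y) /
          ((1 - q) ^ 3 * ((1 - q) * (1 + q)))))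
    = ((1 - q ^ 5 * y) / ((1 - q) * (1 + q + q ^ 2))
          + 2 * (q ^ 2 - q ^ 2 * y) / ((1 - q) * (1 + q))) *
        ((1 - q * y) / (1 - q)) *
        ((1 - q * y) * (1 - y) / ((1 - q) * ((1 - q) * (1 + q)))) := by
  field_simp
  ring

theorem aux_ne (k : ℕ) (hk : k ≠ 0) : (1 : RatFunc ℚ) - RatFunc.X ^ k ≠ 0 := by
  intro h
  have h' : algebraMap (Polynomial ℚ) (RatFunc ℚ) (Polynomial.X ^ k)
      = algebraMap (Polynomial ℚ) (RatFunc ℚ) 1 := by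
    rw [map_pow, RatFunc.algebraMap_X, map_one]
    exact (sub_eq_zero.mp h).symm
  have h2 := congrArg (Polynomial.eval 0) (RatFunc.algebraMap_injective ℚ h')
  simp [hk] at h2

/-- The Poincaré polynomial computation of Kiem–Moon, Theorem 1.4(1): in the field `ℚ(t)`
of rational functions with generator `t = RatFunc.X`, the sum of the equivariant Poincaré
series of the stable locus of `ℙ(Sym³ℂ²⊗ℂⁿ)` and the contributions of the three blow-ups,
minus the contributions of the two blow-downs, equals the closed-form Poincaré polynomial
of `M̄₀,₀(ℙ^{n-1},3)`. -/
theorem stmt1 (n : ℕ) (hn : 2 ≤ n) (t : RatFunc ℚ) (ht : t = RatFunc.X) :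
    ((1 - t ^ (4 * n - 2)) * (1 - t ^ (4 * n)) / ((1 - t ^ 2) * (1 - t ^ 4)))
    + (((t ^ 2 - t ^ (6 * n - 6)) / (1 - t ^ 2)) * ((1 - t ^ (2 * n)) / (1 - t ^ 2)))
    + (((t ^ 2 - t ^ (4 * n - 4)) / (1 - t ^ 2)) *
        ((1 + t ^ 2 + t ^ 4) *
          ((1 - t ^ (2 * n)) * (1 - t ^ (2 * n - 2)) / ((1 - t ^ 2) * (1 - t ^ 4)))))
    + (((t ^ 2 - t ^ (2 * n - 2)) / (1 - t ^ 2)) *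
        ((1 + t ^ 2) *
          ((1 - t ^ (2 * n)) ^ 2 * (1 - t ^ (2 * n - 2)) / (1 - t ^ 2) ^ 3)))
    - ((t ^ 2 / (1 + t ^ 2)) *
        ((1 + t ^ 2 + t ^ 4) *
            ((1 - t ^ (2 * n)) * (1 - t ^ (2 * n - 2)) * (1 - t ^ (4 * n - 4)) /
              ((1 - t ^ 2) ^ 2 * (1 - t ^ 4)))
          + ((t ^ 2 - t ^ (2 * n - 2)) / (1 - t ^ 2)) * (1 + t ^ 2) ^ 2 *
              ((1 - t ^ (2 * n - 2)) ^ 2 * (1 - t ^ (2 * n)) /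
                ((1 - t ^ 2) ^ 2 * (1 - t ^ 4)))))
    - (((t ^ 2 + t ^ 4) / (1 + t ^ 2 + t ^ 4)) *
        ((1 - t ^ (2 * n)) ^ 2 * (1 - t ^ (2 * n - 2)) * (1 - t ^ (2 * n + 2)) /
          ((1 - t ^ 2) ^ 3 * (1 - t ^ 4))))
    = ((1 - t ^ (2 * n + 8)) / (1 - t ^ 6) + 2 * (t ^ 4 - t ^ (2 * n + 2)) / (1 - t ^ 4)) *
        ((1 - t ^ (2 * n)) / (1 - t ^ 2)) *
        ((1 - t ^ (2 * n)) * (1 - t ^ (2 * n - 2)) / ((1 - t ^ 2) * (1 - t ^ 4))) := by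
  obtain ⟨m, rfl⟩ : ∃ m, n = m + 1 := ⟨n - 1, by omega⟩
  have g2 : 1 - t ^ 2 ≠ 0 := ht ▸ aux_ne 2 (by norm_num)
  have g4 : 1 - t ^ 4 ≠ 0 := ht ▸ aux_ne 4 (by norm_num)
  have g6 : 1 - t ^ 6 ≠ 0 := ht ▸ aux_ne 6 (by norm_num)
  clear ht
  have e4 : 1 - t ^ 4 = (1 - t ^ 2) * (1 + t ^ 2) := by ring
  have e6 : 1 - t ^ 6 = (1 - t ^ 2) * (1 + t ^ 2 + (t ^ 2) ^ 2) := by ring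
  have h2 : 1 + t ^ 2 ≠ 0 := right_ne_zero_of_mul (e4 ▸ g4)
  have h3 : 1 + t ^ 2 + (t ^ 2) ^ 2 ≠ 0 := right_ne_zero_of_mul (e6 ▸ g6)
  have key := aux_field (t ^ 2) (t ^ (2 * m)) g2 h2 h3
  have p1 : t ^ (4 * (m + 1) - 2) = t ^ 2 * (t ^ (2 * m)) ^ 2 := by
    rw [show 4 * (m + 1) - 2 = 2 + 2 * m * 2 by omega]; ring
  have p2 : t ^ (4 * (m + 1)) = (t ^ 2) ^ 2 * (t ^ (2 * m)) ^ 2 := by ring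
  have p3 : t ^ (6 * (m + 1) - 6) = (t ^ (2 * m)) ^ 3 := by
    rw [show 6 * (m + 1) - 6 = 2 * m * 3 by omega]; ring
  have p4 : t ^ (2 * (m + 1)) = t ^ 2 * t ^ (2 * m) := by ring
  have p5 : t ^ (4 * (m + 1) - 4) = (t ^ (2 * m)) ^ 2 := by
    rw [show 4 * (m + 1) - 4 = 2 * m * 2 by omega]; ring
  have p6 : t ^ (2 * (m + 1) - 2) = t ^ (2 * m) := by
    rw [show 2 * (m + 1) - 2 = 2 * m by omega]
  have p7 : t ^ (2 * (m + 1) + 2) = (t ^ 2) ^ 2 * t ^ (2 * m) := by ring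
  have p8 : t ^ (2 * (m + 1) + 8) = (t ^ 2) ^ 5 * t ^ (2 * m) := by ring
  have p9 : t ^ 4 = (t ^ 2) ^ 2 := by ring
  rw [p1, p2, p3, p4, p5, p6, p7, p8, e4, e6, p9]
  exact key
end

section
/- For every integer n ≥ 1, the polynomials P₁, P₂, P₃ ∈ ℚ[ξ,α,ρ] are pairwise coprime: for each pair i ≠ j, every polynomial dividing both P_i and P_j in ℚ[ξ,α,ρ] is a unit. -/
open MvPolynomial

/-- The variable `ξ` of `ℚ[ξ,α,ρ]`. -/
noncomputable def xiVar : MvPolynomial (Fin 3) ℚ := X 0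
/-- The variable `α` of `ℚ[ξ,α,ρ]`. -/
noncomputable def alVar : MvPolynomial (Fin 3) ℚ := X 1
/-- The variable `ρ` of `ℚ[ξ,α,ρ]`. -/
noncomputable def rhVar : MvPolynomial (Fin 3) ℚ := X 2

/-- `P₁ = ∑_{k=1}^{n} (n choose k)·ξ^{n−k}·((ρ+2α)^{k−1} + (ρ−2α)^{k−1})`. -/
noncomputable def P1 (n : ℕ) : MvPolynomial (Fin 3) ℚ :=
  ∑ k ∈ Finset.Icc 1 n, (n.choose k : MvPolynomial (Fin 3) ℚ) * xiVar ^ (n - k) *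
    ((rhVar + 2 * alVar) ^ (k - 1) + (rhVar - 2 * alVar) ^ (k - 1))

/-- `P₂ = (ρ+2α+ξ)^n + (ρ−2α+ξ)^n`. -/
noncomputable def P2 (n : ℕ) : MvPolynomial (Fin 3) ℚ :=
  (rhVar + 2 * alVar + xiVar) ^ n + (rhVar - 2 * alVar + xiVar) ^ n

/-- `P₃ = ξ^n·ρ`. -/
noncomputable def P3 (n : ℕ) : MvPolynomial (Fin 3) ℚ := xiVar ^ n * rhVar

lemma aux_sum {R : Type*} [CommRing R] [IsDomain R] (n : ℕ) (a z : R) (ha : a ≠ 0) :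
    ∑ k ∈ Finset.Icc 1 n, (n.choose k : R) * z ^ (n - k) * a ^ (k - 1)
      = ∑ i ∈ Finset.range n, (a + z) ^ i * z ^ (n - 1 - i) := by
  apply mul_left_cancel₀ ha
  have h1 : a * ∑ i ∈ Finset.range n, (a + z) ^ i * z ^ (n - 1 - i) = (a + z) ^ n - z ^ n := by
    have := (Commute.all (a + z) z).geom_sum₂_mul n
    rw [← this]; ring
  rw [h1, add_pow, Finset.sum_range_succ', Finset.mul_sum]
  have : Finset.Icc 1 n = (Finset.range n).image (· + 1) := by
    ext k
    simp only [Finset.mem_Icc, Finset.mem_image, Finset.mem_range]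
    constructor
    · rintro ⟨h, h'⟩
      exact ⟨k - 1, by omega, by omega⟩
    · rintro ⟨j, h, rfl⟩
      omega
  rw [this, Finset.sum_image (by intro x _ y _ h; simpa using h)]
  simp only [pow_zero, Nat.sub_zero, Nat.choose_zero_right, Nat.cast_one, mul_one, one_mul,
    add_sub_cancel_right, Nat.add_sub_cancel]
  apply Finset.sum_congr rfl
  intro k _
  ring

lemma unit_of_dvd_P3 (n : ℕ) (Q : MvPolynomial (Fin 3) ℚ) (v w : Fin 3 → ℚ)
    (hv : v 0 = 0) (hv' : eval v Q ≠ 0) (hw : w 2 = 0) (hw' : eval w Q ≠ 0)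
    (d : MvPolynomial (Fin 3) ℚ) (h1 : d ∣ Q) (h3 : d ∣ P3 n) : IsUnit d := by
  by_contra hd
  have hd0 : d ≠ 0 := by
    rintro rfl
    rw [zero_dvd_iff] at h1
    simp [h1] at hv'
  obtain ⟨p, hp, hpd⟩ := WfDvdMonoid.exists_irreducible_factor hd hd0
  have key : ∀ (i : Fin 3) (u : Fin 3 → ℚ), u i = 0 → eval u Q ≠ 0 → ¬ p ∣ X i := by
    intro i u hu hu' hpi
    have hX : Irreducible (X i : MvPolynomial (Fin 3) ℚ) := (X_prime (R := ℚ) (i := i)).irreducible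
    have hass := hp.associated_of_dvd hX hpi
    obtain ⟨c, hc⟩ := hass.symm.dvd.trans (hpd.trans h1)
    apply hu'
    rw [hc]
    simp [hu]
  rcases hp.prime.dvd_or_dvd (hpd.trans h3) with h | h
  · exact key 0 v hv hv' (hp.prime.dvd_of_dvd_pow h)
  · exact key 2 w hw hw' h

noncomputable def psi : MvPolynomial (Fin 3) ℚ →ₐ[ℚ] Polynomial (MvPolynomial (Fin 2) ℚ) :=
  aeval ![Polynomial.X,
    Polynomial.C (C (1/4) * (X 0 - X 1)),
    Polynomial.C (C (1/2) * (X 0 + X 1)) - Polynomial.X]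

noncomputable def theta : Polynomial (MvPolynomial (Fin 2) ℚ) →+* MvPolynomial (Fin 3) ℚ :=
  Polynomial.eval₂RingHom
    (aeval (R := ℚ) ![rhVar + 2 * alVar + xiVar, rhVar - 2 * alVar + xiVar]).toRingHom xiVar

lemma C_half (m : MvPolynomial (Fin 3) ℚ) : C (1/2) * (2 * m) = m := by
  rw [← mul_assoc, show (2 : MvPolynomial (Fin 3) ℚ) = C 2 from rfl, ← C_mul]; norm_num

lemma C_quarter (m : MvPolynomial (Fin 3) ℚ) : C (1/4) * (4 * m) = m := by
  rw [← mul_assoc, show (4 : MvPolynomial (Fin 3) ℚ) = C 4 from rfl, ← C_mul]; norm_num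

lemma theta_psi (d : MvPolynomial (Fin 3) ℚ) : theta (psi d) = d := by
  have : theta.comp psi.toRingHom = RingHom.id _ := by
    apply MvPolynomial.ringHom_ext
    · intro r
      simp [psi, theta, Polynomial.algebraMap_apply, MvPolynomial.algebraMap_eq]
    · intro i
      fin_cases i
      · simp [psi, theta, xiVar]
      · have := C_quarter (X 1)
        simp [psi, theta, xiVar, alVar, rhVar, MvPolynomial.algebraMap_eq] at this ⊢
        linear_combination this
      · have := C_half (X 2 + X 0)
        simp [psi, theta, xiVar, alVar, rhVar, MvPolynomial.algebraMap_eq] at this ⊢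
        linear_combination this
  exact congrArg (fun f => f d) this

lemma psi_xi : psi xiVar = Polynomial.X := by simp [psi, xiVar]

lemma C_two_quarter : (4 : Polynomial (MvPolynomial (Fin 2) ℚ)) *
    Polynomial.C (C (1/4)) = 1 := by
  rw [show (4 : Polynomial (MvPolynomial (Fin 2) ℚ)) = Polynomial.C (C 4) from rfl,
    ← Polynomial.C_mul, ← C_mul]; norm_num

lemma C_two_half : (2 : Polynomial (MvPolynomial (Fin 2) ℚ)) *
    Polynomial.C (C (1/2)) = 1 := by
  rw [show (2 : Polynomial (MvPolynomial (Fin 2) ℚ)) = Polynomial.C (C 2) from rfl,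
    ← Polynomial.C_mul, ← C_mul]; norm_num

lemma C_half_quarter : (2 : Polynomial (MvPolynomial (Fin 2) ℚ)) *
    Polynomial.C (C (1/4)) = Polynomial.C (C (1/2)) := by
  rw [show (2 : Polynomial (MvPolynomial (Fin 2) ℚ)) = Polynomial.C (C 2) from rfl,
    ← Polynomial.C_mul, ← C_mul]; norm_num

lemma psi_al : psi alVar = Polynomial.C (C (1/4)) * (Polynomial.C (X 0) - Polynomial.C (X 1)) := by
  simp only [psi, alVar, aeval_X, ← Polynomial.C_mul, ← Polynomial.C_sub]; rfl

lemma psi_rh : psi rhVar = Polynomial.C (C (1/2)) * (Polynomial.C (X 0) + Polynomial.C (X 1))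
    - Polynomial.X := by
  simp only [psi, rhVar, aeval_X, ← Polynomial.C_mul, ← Polynomial.C_add]; rfl

lemma psi_x : psi (rhVar + 2 * alVar + xiVar) = Polynomial.C (X 0) := by
  simp only [map_add, map_mul, psi_xi, psi_al, psi_rh, map_ofNat]
  linear_combination (Polynomial.C (X 0) - Polynomial.C (X 1)) * C_half_quarter
    + Polynomial.C (X 0) * C_two_half

lemma psi_y : psi (rhVar - 2 * alVar + xiVar) = Polynomial.C (X 1) := by
  simp only [map_add, map_sub, map_mul, psi_xi, psi_al, psi_rh, map_ofNat]
  linear_combination -(Polynomial.C (X 0) - Polynomial.C (X 1)) * C_half_quarter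
    + Polynomial.C (X 1) * C_two_half

lemma ne1 : rhVar + 2 * alVar ≠ 0 := by
  intro h
  have := congrArg (eval ![0, 0, 1]) h
  simp [rhVar, alVar] at this

lemma ne2 : rhVar - 2 * alVar ≠ 0 := by
  intro h
  have := congrArg (eval ![0, 0, 1]) h
  simp [rhVar, alVar] at this

lemma P1_eq (n : ℕ) : P1 n = ∑ i ∈ Finset.range n, ((rhVar + 2 * alVar + xiVar) ^ i
    + (rhVar - 2 * alVar + xiVar) ^ i) * xiVar ^ (n - 1 - i) := by
  simp only [P1, mul_add, add_mul _ _ (xiVar ^ _), Finset.sum_add_distrib]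
  have h1 := aux_sum n _ xiVar ne1
  have h2 := aux_sum n _ xiVar ne2
  rw [h1, h2]

lemma coeff_psi_P1 (n : ℕ) (hn : 1 ≤ n) : (psi (P1 n)).coeff (n - 1) = 2 := by
  have h : psi (P1 n) = ∑ i ∈ Finset.range n,
      Polynomial.C (X 0 ^ i + X 1 ^ i) * Polynomial.X ^ (n - 1 - i) := by
    rw [P1_eq, map_sum]
    apply Finset.sum_congr rfl
    intro i _
    rw [map_mul, map_add, map_pow, map_pow, map_pow, psi_x, psi_y, psi_xi]
    simp
  rw [h, Polynomial.finsetSum_coeff, Finset.sum_eq_single 0]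
  · rw [Polynomial.coeff_C_mul_X_pow]; norm_num
  · intro i hi hi0
    rw [Polynomial.coeff_C_mul_X_pow, if_neg]
    have := Finset.mem_range.1 hi
    omega
  · intro h
    exact absurd (Finset.mem_range.2 (by omega)) h

lemma unit12 (n : ℕ) (hn : 1 ≤ n) (d : MvPolynomial (Fin 3) ℚ) (h1 : d ∣ P1 n) (h2 : d ∣ P2 n) :
    IsUnit d := by
  have e2 : psi (P2 n) = Polynomial.C (X 0 ^ n + X 1 ^ n) := by
    rw [P2, map_add, map_pow, map_pow, psi_x, psi_y]; simp
  have hne : (X 0 ^ n + X 1 ^ n : MvPolynomial (Fin 2) ℚ) ≠ 0 := by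
    intro h
    have := congrArg (eval ![1, 1]) h
    norm_num at this
  have d2 : psi d ∣ Polynomial.C (X 0 ^ n + X 1 ^ n) := e2 ▸ map_dvd psi h2
  have hdeg := Polynomial.natDegree_le_of_dvd d2 (by simpa only [ne_eq, Polynomial.C_eq_zero] using hne)
  rw [Polynomial.natDegree_C] at hdeg
  have hC := Polynomial.eq_C_of_natDegree_le_zero hdeg
  have d1 : psi d ∣ psi (P1 n) := map_dvd psi h1
  rw [hC, Polynomial.C_dvd_iff_dvd_coeff] at d1
  have d3 := d1 (n - 1)
  rw [coeff_psi_P1 n hn] at d3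
  have u2 : IsUnit (2 : MvPolynomial (Fin 2) ℚ) := by
    rw [show (2 : MvPolynomial (Fin 2) ℚ) = C 2 from rfl]
    exact (IsUnit.mk0 (2 : ℚ) (by norm_num)).map C
  have u := (isUnit_of_dvd_unit d3 u2).map (Polynomial.C)
  rw [← hC] at u
  have := u.map theta
  rwa [theta_psi] at this

/-- The three relations `P₁, P₂, P₃` in the presentation of `H*(M̄₀,₀(ℙ^{n−1},2);ℚ)` of
Kiem–Moon, Theorem 1.3(1), are pairwise coprime: every common divisor of two of them is
a unit. -/
theorem stmt2 (n : ℕ) (hn : 1 ≤ n) :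
    (∀ d : MvPolynomial (Fin 3) ℚ, d ∣ P1 n → d ∣ P2 n → IsUnit d) ∧
    (∀ d : MvPolynomial (Fin 3) ℚ, d ∣ P1 n → d ∣ P3 n → IsUnit d) ∧
    (∀ d : MvPolynomial (Fin 3) ℚ, d ∣ P2 n → d ∣ P3 n → IsUnit d) := by
  refine ⟨unit12 n hn, fun d => ?_, fun d => ?_⟩
  · refine unit_of_dvd_P3 n (P1 n) (fun i => if i = 2 then 1 else 0) (fun i => if i = 0 then 1 else 0) rfl ?_ rfl ?_ d
    · rw [P1_eq, map_sum, Finset.sum_eq_single (n - 1)]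
      · norm_num [xiVar, alVar, rhVar, show (1 : Fin 3) ≠ 2 by decide, show (0 : Fin 3) ≠ 2 by decide, show (2 : Fin 3) ≠ 0 by decide]
      · intro i hi hi'
        have := Finset.mem_range.1 hi
        have : n - 1 - i ≠ 0 := by omega
        simp [xiVar, this]
      · intro h
        exact absurd (Finset.mem_range.2 (by omega)) h
    · rw [P1_eq, map_sum]
      norm_num [xiVar, alVar, rhVar, show (1 : Fin 3) ≠ 2 by decide, show (0 : Fin 3) ≠ 2 by decide, show (2 : Fin 3) ≠ 0 by decide]
      omega
  · refine unit_of_dvd_P3 n (P2 n) (fun i => if i = 2 then 1 else 0) (fun i => if i = 0 then 1 else 0) rfl ?_ rfl ?_ d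
    · norm_num [P2, xiVar, alVar, rhVar, show (1 : Fin 3) ≠ 2 by decide, show (0 : Fin 3) ≠ 2 by decide, show (2 : Fin 3) ≠ 0 by decide]
    · norm_num [P2, xiVar, alVar, rhVar, show (1 : Fin 3) ≠ 2 by decide, show (0 : Fin 3) ≠ 2 by decide, show (2 : Fin 3) ≠ 0 by decide]
end

section
/- For every integer n ≥ 2, the triple (P₁, P₂, P₃) is a regular sequence in ℚ[ξ,α,ρ]: P₁ is a nonzerodivisor, P₂ is a nonzerodivisor modulo ⟨P₁⟩, P₃ is a nonzerodivisor modulo ⟨P₁,P₂⟩, and the ideal ⟨P₁,P₂,P₃⟩ is proper. -/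
open MvPolynomial

/-- substitution `X i = 0` -/
noncomputable def killVar (i : Fin 3) :
    MvPolynomial (Fin 3) ℚ →ₐ[ℚ] MvPolynomial (Fin 3) ℚ :=
  aeval (fun j => if j = i then 0 else X j)

theorem killVar_X (i j : Fin 3) :
    killVar i (X j) = if j = i then 0 else X j := by
  simp [killVar]

theorem killVar_dvd (i : Fin 3) (x : MvPolynomial (Fin 3) ℚ) :
    (X i : MvPolynomial (Fin 3) ℚ) ∣ x - killVar i x := by
  induction x using MvPolynomial.induction_on with
  | C a => simp [killVar]
  | add p q hp hq =>
    have := dvd_add hp hq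
    rw [map_add]
    convert this using 1
    ring
  | mul_X p j hp =>
    rw [map_mul, killVar_X]
    split_ifs with h
    · subst h; simp
    · rw [← sub_mul]; exact hp.mul_right _

theorem killVar_totalDegree (i : Fin 3) (x : MvPolynomial (Fin 3) ℚ) :
    (killVar i x).totalDegree ≤ x.totalDegree := by
  conv_lhs => rw [← sum_homogeneousComponent x, map_sum]
  refine totalDegree_finsetSum_le fun j hj => ?_
  have h : (killVar i (homogeneousComponent j x)).IsHomogeneous (1 * j) := by
    refine (homogeneousComponent_isHomogeneous j x).aeval _ fun k => ?_
    split_ifs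
    · exact isHomogeneous_zero _ _ _
    · exact isHomogeneous_X _ _
  have := h.totalDegree_le
  have := Finset.mem_range.mp hj
  lia

theorem relPrime_syz {P Q u v : MvPolynomial (Fin 3) ℚ} (h : IsRelPrime P Q) (hQ : Q ≠ 0)
    (e : u * P + v * Q = 0) : ∃ w, u = w * Q ∧ v = - (w * P) := by
  have h1 : Q ∣ u * P := ⟨-v, by linear_combination e⟩
  obtain ⟨w, hw⟩ := h.symm.dvd_of_dvd_mul_right h1
  refine ⟨w, by rw [hw]; ring, ?_⟩
  apply mul_right_cancel₀ hQ
  linear_combination e - P * hw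

theorem X_regular (i : Fin 3) {P Q : MvPolynomial (Fin 3) ℚ}
    (h : IsRelPrime (killVar i P) (killVar i Q)) (hQ : killVar i Q ≠ 0)
    (x : MvPolynomial (Fin 3) ℚ) (hx : x * X i ∈ Ideal.span {P, Q}) :
    x ∈ Ideal.span {P, Q} := by
  rw [Ideal.mem_span_pair] at hx ⊢
  obtain ⟨u, v, e⟩ := hx
  have e' := congrArg (killVar i) e
  simp only [map_add, map_mul, killVar_X, if_true, mul_zero] at e'
  obtain ⟨w, hu, hv⟩ := relPrime_syz h hQ e'
  obtain ⟨u', hu'⟩ := killVar_dvd i u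
  obtain ⟨v', hv'⟩ := killVar_dvd i v
  obtain ⟨p, hp⟩ := killVar_dvd i P
  obtain ⟨q, hq⟩ := killVar_dvd i Q
  refine ⟨u' - w * q, v' + w * p, ?_⟩
  apply mul_right_cancel₀ (X_ne_zero (R := ℚ) i)
  linear_combination e - P * hu' - Q * hv' - P * hu - Q * hv + w * P * hq - w * Q * hp

theorem no_common {q : MvPolynomial (Fin 3) ℚ} (hq : Irreducible q) {i j : Fin 3} (hij : i ≠ j)
    (h1 : q ∣ X i) (h2 : q ∣ X j) : False := by
  have h3 : Irreducible (X i : MvPolynomial (Fin 3) ℚ) := (X_prime (i := i)).irreducible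
  have h4 := (hq.associated_of_dvd h3 h1).symm.dvd.trans h2
  exact hij (X_dvd_X.mp h4)

theorem dvd_of_two {q x : MvPolynomial (Fin 3) ℚ} (h : q ∣ 2 * x) : q ∣ x := by
  have e : x = C (1/2 : ℚ) * (2 * x) := by
    have : (2 : MvPolynomial (Fin 3) ℚ) = C 2 := (map_ofNat C 2).symm
    rw [this, ← mul_assoc, ← C_mul]; norm_num
  rw [e]; exact h.mul_left _

theorem P1_hom (n : ℕ) : (P1 n).IsHomogeneous (n - 1) := by
  have h2 : (2 * alVar).IsHomogeneous 1 := by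
    have : (2 : MvPolynomial (Fin 3) ℚ) = C 2 := (map_ofNat C 2).symm
    rw [this]; exact (isHomogeneous_X _ _).C_mul _
  have hr : rhVar.IsHomogeneous 1 := isHomogeneous_X _ _
  have hx : xiVar.IsHomogeneous 1 := isHomogeneous_X _ _
  refine IsHomogeneous.sum _ _ _ fun k hk => ?_
  rw [Finset.mem_Icc] at hk
  have hc : ((n.choose k : ℕ) : MvPolynomial (Fin 3) ℚ) = C (n.choose k : ℚ) := by simp
  rw [hc, mul_assoc]
  apply IsHomogeneous.C_mul
  have := (hx.pow (n - k)).mul (((hr.add h2).pow (k - 1)).add ((hr.sub h2).pow (k - 1)))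
  convert this using 1
  lia

theorem kill0_P1 (n : ℕ) (hn : 2 ≤ n) :
    killVar 0 (P1 n) = (X 2 + 2 * X 1) ^ (n - 1) + (X 2 - 2 * X 1) ^ (n - 1) := by
  unfold P1 xiVar alVar rhVar
  simp only [map_sum, map_mul, map_add, map_sub, map_pow, map_natCast, map_ofNat, killVar_X]
  rw [Finset.sum_eq_single n]
  · simp
  · intro k hk hkn
    rw [Finset.mem_Icc] at hk
    have : n - k ≠ 0 := by lia
    simp [this]
  · intro h; simp at h; lia

theorem kill0_P2 (n : ℕ) :
    killVar 0 (P2 n) = (X 2 + 2 * X 1) ^ n + (X 2 - 2 * X 1) ^ n := by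
  unfold P2 xiVar alVar rhVar
  simp [map_add, map_sub, map_pow, map_ofNat, killVar_X]

theorem kill2_P2 (n : ℕ) :
    killVar 2 (P2 n) = (2 * X 1 + X 0) ^ n + (-(2 * X 1) + X 0) ^ n := by
  unfold P2 xiVar alVar rhVar
  simp [map_add, map_sub, map_pow, map_ofNat, killVar_X]

theorem binom_aux (n : ℕ) (a x : MvPolynomial (Fin 3) ℚ) :
    a * ∑ k ∈ Finset.Icc 1 n, (n.choose k : MvPolynomial (Fin 3) ℚ) * x ^ (n - k) * a ^ (k - 1)
      = (a + x) ^ n - x ^ n := by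
  rw [add_pow, Finset.sum_range_succ', Finset.mul_sum, ← Finset.Ico_succ_right_eq_Icc]
  simp only [Nat.succ_eq_succ, Finset.sum_Ico_eq_sum_range]
  simp only [pow_zero, Nat.sub_zero, Nat.choose_zero_right, Nat.cast_one, mul_one, one_mul,
    add_sub_cancel_right]
  refine Finset.sum_congr (by simp) fun k _ => ?_
  rw [add_comm 1 k, Nat.add_sub_cancel, pow_succ]
  ring

theorem kill2_P1 (n : ℕ) :
    2 * X 1 * killVar 2 (P1 n) = (2 * X 1 + X 0) ^ n - (-(2 * X 1) + X 0) ^ n := by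
  have h1 := binom_aux n (2 * X 1) (X 0)
  have h2 := binom_aux n (-(2 * X 1)) (X 0)
  have : killVar 2 (P1 n) =
      (∑ k ∈ Finset.Icc 1 n, (n.choose k : MvPolynomial (Fin 3) ℚ) * X 0 ^ (n - k) *
        (2 * X 1) ^ (k - 1)) +
      ∑ k ∈ Finset.Icc 1 n, (n.choose k : MvPolynomial (Fin 3) ℚ) * X 0 ^ (n - k) *
        (-(2 * X 1)) ^ (k - 1) := by
    unfold P1 xiVar alVar rhVar
    simp [map_sum, map_ofNat, killVar_X, mul_add, Finset.sum_add_distrib]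
  rw [this]
  linear_combination h1 - h2

theorem kill0_P1_ne (n : ℕ) (hn : 2 ≤ n) : killVar 0 (P1 n) ≠ 0 := by
  rw [kill0_P1 n hn]
  intro h
  have := congrArg (eval ![0, 0, (1 : ℚ)]) h
  simp at this

theorem kill0_P2_ne (n : ℕ) : killVar 0 (P2 n) ≠ 0 := by
  rw [kill0_P2 n]
  intro h
  have := congrArg (eval ![0, 0, (1 : ℚ)]) h
  simp at this

theorem kill2_P2_ne (n : ℕ) : killVar 2 (P2 n) ≠ 0 := by
  rw [kill2_P2 n]
  intro h
  have := congrArg (eval ![1, 0, (0 : ℚ)]) h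
  simp at this

theorem rel0 (n : ℕ) (hn : 2 ≤ n) : IsRelPrime (killVar 0 (P1 n)) (killVar 0 (P2 n)) := by
  apply WfDvdMonoid.isRelPrime_of_no_irreducible_factors (fun h => kill0_P2_ne n h.2)
  intro q hq hA hB
  have hp := hq.prime
  rw [kill0_P1 n hn] at hA
  rw [kill0_P2 n] at hB
  obtain ⟨m, rfl⟩ : ∃ m, n = m + 2 := ⟨n - 2, by lia⟩
  simp only [show m + 2 - 1 = m + 1 by lia] at hA
  set a : MvPolynomial (Fin 3) ℚ := X 2 + 2 * X 1 with ha
  set b : MvPolynomial (Fin 3) ℚ := X 2 - 2 * X 1 with hb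
  have fin : q ∣ a → q ∣ b → False := by
    intro h1 h2
    have h3 : q ∣ X 2 := dvd_of_two (by
      have := dvd_add h1 h2
      rwa [show a + b = 2 * X 2 by rw [ha, hb]; ring] at this)
    have h4 : q ∣ X 1 := dvd_of_two (dvd_of_two (by
      have := dvd_sub h1 h2
      rwa [show a - b = 2 * (2 * X 1) by rw [ha, hb]; ring] at this))
    exact no_common hq (by decide) h3 h4
  have h1 : q ∣ b ^ (m + 1) * (b - a) := by
    have := dvd_sub hB (hA.mul_left a)
    convert this using 1
    ring
  rcases hp.dvd_or_dvd h1 with h | h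
  · have hb' := hp.dvd_of_dvd_pow h
    have ha' := hp.dvd_of_dvd_pow ((dvd_add_left h).mp hA)
    exact fin ha' hb'
  · have h5 : q ∣ b ^ (m + 1) - a ^ (m + 1) := h.trans (sub_dvd_pow_sub_pow _ _ _)
    have h6 : q ∣ 2 * b ^ (m + 1) := by
      have := dvd_add hA h5
      convert this using 1
      ring
    have hb' := hp.dvd_of_dvd_pow (dvd_of_two h6)
    have ha' : q ∣ a := by
      have := dvd_sub hb' h
      convert this using 1
      ring
    exact fin ha' hb'

theorem rel2 (n : ℕ) : IsRelPrime (killVar 2 (P1 n)) (killVar 2 (P2 n)) := by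
  apply WfDvdMonoid.isRelPrime_of_no_irreducible_factors (fun h => kill2_P2_ne n h.2)
  intro q hq hA hB
  have hp := hq.prime
  have hA := hA.mul_left (2 * X 1)
  rw [kill2_P1 n] at hA
  rw [kill2_P2 n] at hB
  have h1 : q ∣ 2 * X 1 + X 0 := hp.dvd_of_dvd_pow (n := n) (dvd_of_two (by
    have := dvd_add hA hB
    convert this using 1
    ring))
  have h2 : q ∣ -(2 * X 1) + X 0 := hp.dvd_of_dvd_pow (n := n) (dvd_of_two (by
    have := dvd_sub hB hA
    convert this using 1
    ring))
  have h3 : q ∣ X 0 := dvd_of_two (by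
    have := dvd_add h1 h2
    convert this using 1
    ring)
  have h4 : q ∣ X 1 := dvd_of_two (dvd_of_two (by
    have := dvd_sub h1 h2
    convert this using 1
    ring))
  exact no_common hq (by decide) h3 h4

theorem P1_ne (n : ℕ) (hn : 2 ≤ n) : P1 n ≠ 0 := by
  intro h
  apply kill0_P1_ne n hn
  rw [h, map_zero]

theorem relP (n : ℕ) (hn : 2 ≤ n) : IsRelPrime (P1 n) (P2 n) := by
  intro d h1 h2
  have hu : IsUnit (killVar 0 d) :=
    rel0 n hn (map_dvd (killVar 0) h1) (map_dvd (killVar 0) h2)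
  obtain ⟨e, he⟩ := h1
  have hP := P1_ne n hn
  have hd0 : d ≠ 0 := by rintro rfl; simp at he; exact hP he
  have he0 : e ≠ 0 := by rintro rfl; simp at he; exact hP he
  have hk := kill0_P1_ne n hn
  have hdeg : (killVar 0 (P1 n)).totalDegree = n - 1 := by
    refine IsHomogeneous.totalDegree ?_ hk
    have := (P1_hom n).aeval (fun j => if j = 0 then (0 : MvPolynomial (Fin 3) ℚ) else X j)
      (n := 1) (fun k => by
        split_ifs
        · exact isHomogeneous_zero _ _ _
        · exact isHomogeneous_X _ _)
    rwa [one_mul] at this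
  have hdeg' := (P1_hom n).totalDegree hP
  rw [he, totalDegree_mul_of_isDomain hd0 he0] at hdeg'
  rw [he, map_mul] at hdeg hk
  have hm := totalDegree_mul (killVar 0 d) (killVar 0 e)
  have h3 := (isUnit_iff_totalDegree_of_isReduced.mp hu).2
  have h4 := killVar_totalDegree 0 e
  have h5 : d.totalDegree = 0 := by lia
  have hd := totalDegree_eq_zero_iff_eq_C.mp h5
  rw [hd] at hd0 ⊢
  exact (IsUnit.mk0 _ (fun h => hd0 (by rw [h, C_0]))).map C

/-- For `n ≥ 2`, the triple `(P₁, P₂, P₃)` is a regular sequence in `ℚ[ξ,α,ρ]`: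
`P₁` is a nonzerodivisor, `P₂` is a nonzerodivisor modulo `⟨P₁⟩`, `P₃` is a
nonzerodivisor modulo `⟨P₁,P₂⟩`, and the ideal `⟨P₁,P₂,P₃⟩` is proper. -/
theorem stmt3 (n : ℕ) (hn : 2 ≤ n) :
    (∀ x : MvPolynomial (Fin 3) ℚ, x * P1 n = 0 → x = 0) ∧
    (∀ x : MvPolynomial (Fin 3) ℚ,
      x * P2 n ∈ Ideal.span ({P1 n} : Set (MvPolynomial (Fin 3) ℚ)) →
      x ∈ Ideal.span ({P1 n} : Set (MvPolynomial (Fin 3) ℚ))) ∧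
    (∀ x : MvPolynomial (Fin 3) ℚ,
      x * P3 n ∈ Ideal.span ({P1 n, P2 n} : Set (MvPolynomial (Fin 3) ℚ)) →
      x ∈ Ideal.span ({P1 n, P2 n} : Set (MvPolynomial (Fin 3) ℚ))) ∧
    Ideal.span ({P1 n, P2 n, P3 n} : Set (MvPolynomial (Fin 3) ℚ)) ≠ ⊤ := by
  refine ⟨?_, ?_, ?_, ?_⟩
  · intro x hx
    exact (mul_eq_zero.mp hx).resolve_right (P1_ne n hn)
  · intro x hx
    rw [Ideal.mem_span_singleton] at hx ⊢
    exact (relP n hn).dvd_of_dvd_mul_right hx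
  · intro x hx
    have h1 : x * xiVar ^ n ∈ Ideal.span {P1 n, P2 n} := by
      apply X_regular 2 (rel2 n) (kill2_P2_ne n)
      rwa [P3, ← mul_assoc] at hx
    have key : ∀ m : ℕ, x * xiVar ^ m ∈ Ideal.span {P1 n, P2 n} →
        x ∈ Ideal.span {P1 n, P2 n} := by
      intro m
      induction m with
      | zero => intro h; simpa using h
      | succ m ih =>
        intro h
        apply ih
        apply X_regular 0 (rel0 n hn) (kill0_P2_ne n)
        rwa [pow_succ, ← mul_assoc] at h
    exact key n h1
  · intro h
    have hle : Ideal.span ({P1 n, P2 n, P3 n} : Set (MvPolynomial (Fin 3) ℚ)) ≤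
        RingHom.ker (constantCoeff (σ := Fin 3) (R := ℚ)) := by
      rw [Ideal.span_le]
      have hn0 : n ≠ 0 := by lia
      rintro p (rfl | rfl | rfl)
      · rw [SetLike.mem_coe, RingHom.mem_ker, constantCoeff_eq]
        apply (P1_hom n).coeff_eq_zero
        simp; lia
      · simp [RingHom.mem_ker, P2, xiVar, alVar, rhVar, hn0]
      · simp [RingHom.mem_ker, P3, xiVar, rhVar]
    rw [h] at hle
    have : (1 : MvPolynomial (Fin 3) ℚ) ∈ RingHom.ker (constantCoeff (σ := Fin 3) (R := ℚ)) :=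
      hle trivial
    simp [RingHom.mem_ker] at this
end

section
/- Let n ≥ 1 be an integer and F ∈ ℚ[x,y]. Then u^n divides each of the three polynomials F(u−2z, z²), F(u, z²), F(u+2z, z²) in ℚ[u,z] if and only if x^n·(x²−4y)^n divides F in ℚ[x,y]. -/
open MvPolynomial

abbrev R2 := MvPolynomial (Fin 2) ℚ

theorem dvd_sub_aeval (g : R2) (f : Fin 2 → R2) (h : ∀ i, g ∣ X i - f i) (F : R2) :
    g ∣ F - aeval f F := by
  have : (Ideal.Quotient.mkₐ ℚ (Ideal.span {g})).comp (aeval f)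
      = Ideal.Quotient.mkₐ ℚ (Ideal.span {g}) := by
    apply MvPolynomial.algHom_ext
    intro i
    simp only [AlgHom.comp_apply, aeval_X, Ideal.Quotient.mkₐ_eq_mk]
    symm
    rw [Ideal.Quotient.eq, Ideal.mem_span_singleton]
    exact h i
  have h2 := DFunLike.congr_fun this F
  simp only [AlgHom.comp_apply, Ideal.Quotient.mkₐ_eq_mk] at h2
  rw [← Ideal.mem_span_singleton, ← Ideal.Quotient.eq]
  exact h2.symm

theorem dvd_of_aeval_zero (g : R2) (f : Fin 2 → R2) (h : ∀ i, g ∣ X i - f i) (F : R2)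
    (h0 : aeval f F = 0) : g ∣ F := by
  have := dvd_sub_aeval g f h F
  rwa [h0, sub_zero] at this

theorem set_zero (F : R2) (n : ℕ) (f : Fin 2 → R2) (h : (X 0 : R2) ^ (n + 1) ∣ aeval f F)
    (k : R2 →ₐ[ℚ] R2) (hk : k (X 0) = 0) : aeval (fun i => k (f i)) F = 0 := by
  obtain ⟨c, hc⟩ := h
  have := congrArg k hc
  rw [map_mul, map_pow, hk, zero_pow (Nat.succ_ne_zero n), zero_mul] at this
  rw [← this, ← AlgHom.comp_apply]
  congr 1
  apply MvPolynomial.algHom_ext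
  intro i
  simp

theorem prime_X0 : Prime (X 0 : R2) := MvPolynomial.X_prime

theorem not_dvd_of_eval (p : R2) (h : MvPolynomial.eval ![(0:ℚ), 1] p ≠ 0) :
    ¬ (X 0 : R2) ∣ p := by
  rintro ⟨c, rfl⟩
  simp at h

theorem partA (n : ℕ) : ∀ F : R2,
    (X 0 : R2) ^ n ∣ aeval ![(X 0 : R2) - 2 * X 1, (X 1 : R2) ^ 2] F →
    ((X 0 : R2) ^ 2 - 4 * X 1) ^ n ∣ F := by
  induction n with
  | zero => intro F _; simp
  | succ n ih =>
    intro F h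
    have hC : (C (1/2) : R2) * 2 = 1 := by
      rw [show (2 : R2) = C 2 from (map_ofNat C 2).symm, ← C_mul]; norm_num
    have h0 := set_zero F n _ h (aeval ![0, - C (1/2) * X 0]) (by simp)
    obtain ⟨G, rfl⟩ := dvd_of_aeval_zero ((X 0 : R2) ^ 2 - 4 * X 1) _ (by
      intro i
      fin_cases i
      · simp only [Fin.zero_eta, Matrix.cons_val_zero, map_sub, map_mul, aeval_X, map_ofNat,
          Matrix.cons_val_one]
        refine ⟨0, ?_⟩
        linear_combination (-X 0) * hC
      · simp only [Fin.mk_one, Matrix.cons_val_one, Matrix.cons_val_zero, Matrix.cons_val_fin_one, map_pow, aeval_X]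
        refine ⟨- C (1/2) ^ 2, ?_⟩
        linear_combination (-X 1 * (C (1/2) * 2 + 1)) * hC) F h0
    rw [pow_succ']
    apply mul_dvd_mul_left
    apply ih
    have e : aeval ![(X 0 : R2) - 2 * X 1, (X 1 : R2) ^ 2] (((X 0 : R2) ^ 2 - 4 * X 1) * G)
      = X 0 * ((X 0 - 4 * X 1) * aeval ![(X 0 : R2) - 2 * X 1, (X 1 : R2) ^ 2] G) := by
      simp only [map_mul, map_sub, map_pow, aeval_X, map_ofNat, Matrix.cons_val_zero,
        Matrix.cons_val_one]
      ring
    rw [e, pow_succ', mul_dvd_mul_iff_left prime_X0.ne_zero] at h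
    exact prime_X0.pow_dvd_of_dvd_mul_left n (not_dvd_of_eval _ (by simp)) h

theorem partB (n : ℕ) : ∀ F : R2,
    (X 0 : R2) ^ n ∣ aeval ![(X 0 : R2), (X 1 : R2) ^ 2] F → (X 0 : R2) ^ n ∣ F := by
  induction n with
  | zero => intro F _; simp
  | succ n ih =>
    intro F h
    have h0 := set_zero F n _ h (aeval ![0, X 1]) (by simp)
    have h1 : aeval ![(0 : R2), X 1] F = 0 := by
      apply MvPolynomial.expand_injective (R := ℚ) (σ := Fin 2) (n := 2) (by norm_num)
      rw [map_zero]
      refine Eq.trans ?_ h0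
      rw [← AlgHom.comp_apply]
      congr 1
      apply MvPolynomial.algHom_ext
      intro i
      fin_cases i <;> simp
    obtain ⟨G, rfl⟩ := dvd_of_aeval_zero (X 0 : R2) _ (by
      intro i
      fin_cases i <;> simp) F h1
    rw [pow_succ']
    apply mul_dvd_mul_left
    apply ih
    rw [map_mul, aeval_X, Matrix.cons_val_zero, pow_succ',
      mul_dvd_mul_iff_left prime_X0.ne_zero] at h
    exact h

/-- The concrete content of the localization injection (2.2) for the `SL(2)`-action on
`ℙ(Sym²ℂ²⊗ℂⁿ)` (Kiem–Moon §2.3): for `F ∈ ℚ[x,y]`, `u^n` divides each of the three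
substituted polynomials `F(u−2z, z²)`, `F(u, z²)`, `F(u+2z, z²)` in `ℚ[u,z]` if and only
if `x^n·(x²−4y)^n` divides `F` in `ℚ[x,y]`. -/
theorem stmt9 (n : ℕ) (hn : 1 ≤ n) (F : MvPolynomial (Fin 2) ℚ) :
    ((X 0 : MvPolynomial (Fin 2) ℚ) ^ n ∣
        MvPolynomial.aeval
          ![(X 0 : MvPolynomial (Fin 2) ℚ) - 2 * X 1, (X 1 : MvPolynomial (Fin 2) ℚ) ^ 2] F ∧
      (X 0 : MvPolynomial (Fin 2) ℚ) ^ n ∣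
        MvPolynomial.aeval
          ![(X 0 : MvPolynomial (Fin 2) ℚ), (X 1 : MvPolynomial (Fin 2) ℚ) ^ 2] F ∧
      (X 0 : MvPolynomial (Fin 2) ℚ) ^ n ∣
        MvPolynomial.aeval
          ![(X 0 : MvPolynomial (Fin 2) ℚ) + 2 * X 1, (X 1 : MvPolynomial (Fin 2) ℚ) ^ 2] F)
    ↔ (X 0 : MvPolynomial (Fin 2) ℚ) ^ n *
        ((X 0 : MvPolynomial (Fin 2) ℚ) ^ 2 - 4 * X 1) ^ n ∣ F := by
  constructor
  · rintro ⟨h1, h2, -⟩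
    obtain ⟨G, rfl⟩ := partA n F h1
    have h := partB n _ h2
    rw [mul_comm]
    apply mul_dvd_mul_left
    exact prime_X0.pow_dvd_of_dvd_mul_left n (not_dvd_of_eval _ (by simp)) h
  · rintro ⟨G, rfl⟩
    simp only [map_mul, map_sub, map_pow, aeval_X, map_ofNat, Matrix.cons_val_zero,
        Matrix.cons_val_one]
    refine ⟨?_, ?_, ?_⟩
    · apply Dvd.dvd.mul_right
      apply Dvd.dvd.mul_left
      exact pow_dvd_pow_of_dvd ⟨X 0 - 4 * X 1, by ring⟩ n
    · rw [mul_assoc]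
      exact dvd_mul_right _ _
    · apply Dvd.dvd.mul_right
      apply Dvd.dvd.mul_left
      exact pow_dvd_pow_of_dvd ⟨X 0 + 4 * X 1, by ring⟩ n
end

section
/- Let n ≥ 1 be an integer and F ∈ ℚ[x,y]. Then u^n divides each of the four polynomials F(u−3z, z²), F(u−z, z²), F(u+z, z²), F(u+3z, z²) in ℚ[u,z] if and only if (x²−y)^n·(x²−9y)^n divides F in ℚ[x,y]. -/
open MvPolynomial

theorem aux_A (c : ℚ) (hc : c ≠ 0) (F : MvPolynomial (Fin 2) ℚ)
    (h : (X 0 : MvPolynomial (Fin 2) ℚ) ∣ aeval ![X 0 - C c * X 1, (X 1 : MvPolynomial (Fin 2) ℚ) ^ 2] F) :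
    (X 0 ^ 2 - C (c ^ 2) * X 1 : MvPolynomial (Fin 2) ℚ) ∣ F := by
  have hcc : (C c : MvPolynomial (Fin 2) ℚ) * C c⁻¹ = 1 := by
    rw [← C_mul, mul_inv_cancel₀ hc, C_1]
  obtain ⟨G, hG⟩ := h
  have h0 : aeval ![X 0, C (c⁻¹) ^ 2 * (X 0 : MvPolynomial (Fin 2) ℚ) ^ 2] F = 0 := by
    have := congrArg (aeval ![(0 : MvPolynomial (Fin 2) ℚ), - C c⁻¹ * X 0]) hG
    rw [map_mul, aeval_X] at this
    simp only [Matrix.cons_val_zero, zero_mul] at this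
    rw [← this, ← AlgHom.comp_apply]
    congr 1
    apply MvPolynomial.algHom_ext
    intro i
    fin_cases i
    · simp [algebraMap_eq]
      linear_combination (-X 0) * hcc
    · simp
      ring
  rw [← Ideal.mem_span_singleton, ← Ideal.Quotient.eq_zero_iff_mem]
  set I := Ideal.span {(X 0 ^ 2 - C (c ^ 2) * X 1 : MvPolynomial (Fin 2) ℚ)}
  have h1 : (Ideal.Quotient.mkₐ ℚ I).comp (aeval ![X 0, C (c⁻¹) ^ 2 * (X 0 : MvPolynomial (Fin 2) ℚ) ^ 2])
      = Ideal.Quotient.mkₐ ℚ I := by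
    apply MvPolynomial.algHom_ext
    intro i
    fin_cases i
    · simp
    · simp only [AlgHom.comp_apply, aeval_X, Ideal.Quotient.mkₐ_eq_mk]
      rw [Ideal.Quotient.eq, Ideal.mem_span_singleton]
      refine ⟨C c⁻¹ ^ 2, ?_⟩
      simp only [map_pow]
      simp
      linear_combination (X 1) * (C c * C c⁻¹ + 1) * hcc
  have h2 := DFunLike.congr_fun h1 F
  rw [AlgHom.comp_apply, h0, map_zero] at h2
  exact h2.symm

theorem aux_cancel (n : ℕ) (Q G : MvPolynomial (Fin 2) ℚ) (hQ : aeval ![(0 : ℚ), 1] Q ≠ 0)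
    (h : (X 0 : MvPolynomial (Fin 2) ℚ) ^ n ∣ Q * G) : (X 0 : MvPolynomial (Fin 2) ℚ) ^ n ∣ G := by
  refine (MvPolynomial.X_prime (R := ℚ) (i := (0 : Fin 2))).pow_dvd_of_dvd_mul_left n ?_ h
  rintro ⟨R, rfl⟩
  simp at hQ

theorem aux_B (c : ℚ) (hc : c ≠ 0) (n : ℕ) : ∀ (F : MvPolynomial (Fin 2) ℚ)
    (_ : (X 0 : MvPolynomial (Fin 2) ℚ) ^ n ∣ aeval ![X 0 - C c * X 1, (X 1 : MvPolynomial (Fin 2) ℚ) ^ 2] F),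
    (X 0 ^ 2 - C (c ^ 2) * X 1 : MvPolynomial (Fin 2) ℚ) ^ n ∣ F := by
  induction n with
  | zero => intro F _; simp
  | succ n ih =>
    intro F h
    obtain ⟨G, rfl⟩ := aux_A c hc F ((dvd_pow_self _ n.succ_ne_zero).trans h)
    rw [pow_succ']
    apply mul_dvd_mul_left
    apply ih
    apply aux_cancel n (X 0 - C (2 * c) * X 1)
    · simpa [algebraMap_eq] using hc
    · have e : aeval ![X 0 - C c * X 1, (X 1 : MvPolynomial (Fin 2) ℚ) ^ 2]
          (X 0 ^ 2 - C (c ^ 2) * X 1 : MvPolynomial (Fin 2) ℚ) = X 0 * (X 0 - C (2 * c) * X 1) := by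
        simp [algebraMap_eq]
        rw [show (C 2 : MvPolynomial (Fin 2) ℚ) = 2 from rfl]
        ring
      rw [map_mul, e, pow_succ', mul_assoc] at h
      exact (mul_dvd_mul_iff_left (X_ne_zero _)).1 h

theorem aux_C (p q G : MvPolynomial (Fin 2) ℚ) (n : ℕ)
    (f : MvPolynomial (Fin 2) ℚ →ₐ[ℚ] MvPolynomial (Fin 2) ℚ)
    (h : X 0 ∣ f (p * q)) : X 0 ^ n ∣ f (p ^ n * q ^ n * G) := by
  rw [← mul_pow, map_mul, map_pow]
  exact (pow_dvd_pow_of_dvd h n).mul_right _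

/-- The concrete content of the localization injection (2.2) for the `SL(2)`-action on
`ℙ(Sym³ℂ²⊗ℂⁿ)` (Kiem–Moon §2.3): for `F ∈ ℚ[x,y]`, `u^n` divides each of the four
substituted polynomials `F(u−3z, z²)`, `F(u−z, z²)`, `F(u+z, z²)`, `F(u+3z, z²)` in
`ℚ[u,z]` if and only if `(x²−y)^n·(x²−9y)^n` divides `F` in `ℚ[x,y]`. -/
theorem stmt10 (n : ℕ) (hn : 1 ≤ n) (F : MvPolynomial (Fin 2) ℚ) :
    ((X 0 : MvPolynomial (Fin 2) ℚ) ^ n ∣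
        MvPolynomial.aeval
          ![(X 0 : MvPolynomial (Fin 2) ℚ) - 3 * X 1, (X 1 : MvPolynomial (Fin 2) ℚ) ^ 2] F ∧
      (X 0 : MvPolynomial (Fin 2) ℚ) ^ n ∣
        MvPolynomial.aeval
          ![(X 0 : MvPolynomial (Fin 2) ℚ) - X 1, (X 1 : MvPolynomial (Fin 2) ℚ) ^ 2] F ∧
      (X 0 : MvPolynomial (Fin 2) ℚ) ^ n ∣
        MvPolynomial.aeval
          ![(X 0 : MvPolynomial (Fin 2) ℚ) + X 1, (X 1 : MvPolynomial (Fin 2) ℚ) ^ 2] F ∧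
      (X 0 : MvPolynomial (Fin 2) ℚ) ^ n ∣
        MvPolynomial.aeval
          ![(X 0 : MvPolynomial (Fin 2) ℚ) + 3 * X 1, (X 1 : MvPolynomial (Fin 2) ℚ) ^ 2] F)
    ↔ ((X 0 : MvPolynomial (Fin 2) ℚ) ^ 2 - X 1) ^ n *
        ((X 0 : MvPolynomial (Fin 2) ℚ) ^ 2 - 9 * X 1) ^ n ∣ F := by
  have h3 : (C 3 : MvPolynomial (Fin 2) ℚ) = 3 := rfl
  have h9 : (C 9 : MvPolynomial (Fin 2) ℚ) = 9 := rfl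
  constructor
  · rintro ⟨ha, hb, -, -⟩
    have h1 := aux_B 1 one_ne_zero n F (by simpa using hb)
    simp only [one_pow, C_1, one_mul] at h1
    obtain ⟨G, rfl⟩ := h1
    apply mul_dvd_mul_left
    have h2 := aux_B 3 (by norm_num) n G (by
      rw [h3]
      rw [map_mul] at ha
      refine aux_cancel n _ _ ?_ ha
      simp
      norm_num)
    norm_num at h2
    first | exact h2 | (rw [h9] at h2; exact h2)
  · rintro ⟨G, rfl⟩
    refine ⟨aux_C _ _ _ _ _ ?_, aux_C _ _ _ _ _ ?_, aux_C _ _ _ _ _ ?_, aux_C _ _ _ _ _ ?_⟩ <;>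
      rw [map_mul]
    · refine Dvd.dvd.mul_left ⟨X 0 - 6 * X 1, ?_⟩ _
      simp only [map_sub, map_mul, map_pow, map_ofNat, aeval_X, Matrix.cons_val_zero, Matrix.cons_val_one]
      ring
    · refine Dvd.dvd.mul_right ⟨X 0 - 2 * X 1, ?_⟩ _
      simp
      ring
    · refine Dvd.dvd.mul_right ⟨X 0 + 2 * X 1, ?_⟩ _
      simp
      ring
    · refine Dvd.dvd.mul_left ⟨X 0 + 6 * X 1, ?_⟩ _
      simp only [map_sub, map_mul, map_pow, map_ofNat, aeval_X, Matrix.cons_val_zero, Matrix.cons_val_one]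
      ring
end
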